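/- arXiv:1410.3243 — 2 statements merged into one kernel-verified Lean document; each statement's English description precedes it below -/
import Mathlib

section
/- For n ≥ 1, a ring R is right Central McCoy if and only if the quotient ring R[y]/(yⁿ) is right Central McCoy. -/
def IsRightCentralMcCoy (R : Type*) [Ring R] : Prop :=
  ∀ f g : Polynomial R, f ≠ 0 → g ≠ 0 → f * g = 0 →
    ∃ r : R, r ≠ 0 ∧ ∀ i : ℕ, f.coeff i * r ∈ Set.center R

/-- `R[y]/(yⁿ)`: the quotient of the polynomial ring `R[y]` by the two-sided
ideal generated by `yⁿ`. -/
abbrev PolyModXPow (R : Type*) [Ring R] (n : ℕ) :=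
  (TwoSidedIdeal.span {(Polynomial.X : Polynomial R) ^ n}).ringCon.Quotient

namespace PolyModXPow

open Polynomial

variable {R : Type*} [Ring R] {n : ℕ}

theorem mem_span_X_pow_iff (p : R[X]) :
    p ∈ TwoSidedIdeal.span {(X : R[X]) ^ n} ↔ ∀ i < n, p.coeff i = 0 := by
  rw [← X_pow_dvd_iff]
  constructor
  · intro hp
    let I : TwoSidedIdeal R[X] := TwoSidedIdeal.mk' {q | (X : R[X]) ^ n ∣ q}
      (dvd_zero _) dvd_add (fun h => (dvd_neg).2 h)
      (by
        rintro a _ ⟨b, rfl⟩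
        exact ⟨a * b, by rw [← mul_assoc, ← X_pow_mul, mul_assoc]⟩)
      (fun h => h.mul_right _)
    have hI : p ∈ I := TwoSidedIdeal.mem_span_iff.1 hp I (by
      rintro _ rfl
      simp [I])
    simpa [I] using hI
  · rintro ⟨q, rfl⟩
    exact TwoSidedIdeal.mul_mem_right _ _ _ (TwoSidedIdeal.subset_span rfl)

/-- The quotient map `R[y] → R[y]/(yⁿ)`. -/
noncomputable def proj (R : Type*) [Ring R] (n : ℕ) : R[X] →+* PolyModXPow R n :=
  RingCon.mk' _

theorem proj_surjective : Function.Surjective (proj R n) :=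
  RingCon.mk'_surjective _

theorem proj_eq_proj_iff {p q : R[X]} :
    proj R n p = proj R n q ↔ ∀ i < n, p.coeff i = q.coeff i := by
  have h : proj R n p = proj R n q ↔ p - q ∈ TwoSidedIdeal.span {(X : R[X]) ^ n} :=
    (RingCon.eq _).trans (TwoSidedIdeal.rel_iff _ _ _)
  rw [h, mem_span_X_pow_iff]
  simp only [coeff_sub, sub_eq_zero]

/-- The coefficient of `yⁱ`, for `i < n`, of an element of `R[y]/(yⁿ)`. -/
noncomputable def coeff (i : Fin n) : PolyModXPow R n →+ R where
  toFun q := (Function.surjInv proj_surjective q).coeff i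
  map_zero' := by
    rw [← coeff_zero (R := R) (i : ℕ)]
    refine proj_eq_proj_iff.1 ?_ i i.2
    rw [map_zero, Function.surjInv_eq proj_surjective]
  map_add' a b := by
    rw [← coeff_add]
    refine proj_eq_proj_iff.1 ?_ i i.2
    rw [map_add]
    simp only [Function.surjInv_eq]

@[simp]
theorem coeff_proj (i : Fin n) (p : R[X]) : coeff i (proj R n p) = p.coeff i :=
  proj_eq_proj_iff.1 (Function.surjInv_eq proj_surjective _) i i.2

theorem ext_coeff {a b : PolyModXPow R n} (h : ∀ i, coeff i a = coeff i b) : a = b := by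
  obtain ⟨p, rfl⟩ := proj_surjective a
  obtain ⟨q, rfl⟩ := proj_surjective b
  exact proj_eq_proj_iff.2 fun i hi => by simpa using h ⟨i, hi⟩

theorem exists_coeff_ne_zero {a : PolyModXPow R n} (ha : a ≠ 0) : ∃ i, coeff i a ≠ 0 := by
  by_contra! h
  exact ha (ext_coeff fun i => by simp [h])

/-- If all coefficients of `b` below `j` vanish, the `j`-th coefficient of `a * b` is the
constant coefficient of `a` times the `j`-th coefficient of `b`. -/
theorem coeff_mul_of_lt (hn : 0 < n) (a b : PolyModXPow R n) (j : Fin n)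
    (hb : ∀ i < j, coeff i b = 0) : coeff j (a * b) = coeff ⟨0, hn⟩ a * coeff j b := by
  obtain ⟨p, rfl⟩ := proj_surjective a
  obtain ⟨q, rfl⟩ := proj_surjective b
  rw [← map_mul]
  simp only [coeff_proj] at hb ⊢
  rw [Polynomial.coeff_mul, Finset.sum_eq_single (0, (j : ℕ))]
  · rintro ⟨k, l⟩ hkl hne
    rw [Finset.HasAntidiagonal.mem_antidiagonal] at hkl
    simp only [ne_eq, Prod.mk.injEq, not_and] at hkl hne
    have hl : l < j := by omega
    simp [hb ⟨l, hl.trans j.2⟩ hl]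
  · simp

theorem coeff_mem_center {a : PolyModXPow R n} (ha : a ∈ Set.center (PolyModXPow R n))
    (i : Fin n) : coeff i a ∈ Set.center R := by
  rw [Semigroup.mem_center_iff] at ha ⊢
  intro s
  obtain ⟨p, rfl⟩ := proj_surjective a
  have h := congrArg (coeff i) (ha (proj R n (C s)))
  simpa [← map_mul] using h

theorem proj_C_mul_X_pow_mem_center {c : R} (hc : c ∈ Set.center R) (k : ℕ) :
    proj R n (C c * X ^ k) ∈ Set.center (PolyModXPow R n) := by
  rw [Semigroup.mem_center_iff] at hc ⊢
  intro a
  obtain ⟨p, rfl⟩ := proj_surjective a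
  rw [← map_mul, ← map_mul, ← mul_assoc, mul_assoc (C c), X_pow_mul, ← mul_assoc]
  congr 2
  ext i
  simp [hc]

theorem mul_proj_C_mul_X_pow (hn : 0 < n) (a : PolyModXPow R n) (c : R) :
    a * proj R n (C c * X ^ (n - 1)) =
      proj R n (C (coeff ⟨0, hn⟩ a * c) * X ^ (n - 1)) := by
  obtain ⟨p, rfl⟩ := proj_surjective a
  rw [← map_mul, proj_eq_proj_iff]
  intro i hi
  rw [← mul_assoc, coeff_mul_X_pow', coeff_mul_X_pow']
  split_ifs with h
  · obtain rfl : i = n - 1 := by omega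
    simp
  · rfl

/-- The polynomial over `R` formed by the `i`-th coefficients of the coefficients of `f`. -/
noncomputable def coeffPoly (i : Fin n) (f : (PolyModXPow R n)[X]) : R[X] :=
  ∑ k ∈ f.support, monomial k (coeff i (f.coeff k))

@[simp]
theorem coeff_coeffPoly (i : Fin n) (f : (PolyModXPow R n)[X]) (k : ℕ) :
    (coeffPoly i f).coeff k = coeff i (f.coeff k) := by
  rw [coeffPoly, finsetSum_coeff]
  simp +contextual [coeff_monomial]

theorem coeffPoly_zero_mul_coeffPoly (hn : 0 < n) (f g : (PolyModXPow R n)[X])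
    (j : Fin n) (hg : ∀ i < j, ∀ k, coeff i (g.coeff k) = 0) :
    coeffPoly ⟨0, hn⟩ f * coeffPoly j g = coeffPoly j (f * g) := by
  ext m
  simp only [Polynomial.coeff_mul, coeff_coeffPoly, map_sum]
  exact Finset.sum_congr rfl fun x _ =>
    (coeff_mul_of_lt hn _ _ j fun i hi => hg i hi x.2).symm

theorem isRightCentralMcCoy (hn : 0 < n) (hR : IsRightCentralMcCoy R) :
    IsRightCentralMcCoy (PolyModXPow R n) := by
  intro f g _ hg hfg
  have hex : ∃ j : Fin n, ∃ k, coeff j (g.coeff k) ≠ 0 := by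
    by_contra! h
    exact hg (Polynomial.ext fun k => ext_coeff fun i => by simp [h])
  obtain ⟨j, ⟨k, hk⟩, hmin⟩ := WellFounded.has_min (wellFounded_lt (α := Fin n))
    {j | ∃ k, coeff j (g.coeff k) ≠ 0} hex
  have hlow : ∀ i < j, ∀ k, coeff i (g.coeff k) = 0 := fun i hi k => by
    by_contra h
    exact hmin i ⟨k, h⟩ hi
  have hgj : coeffPoly j g ≠ 0 := fun h => hk (by simp [← coeff_coeffPoly, h])
  have hmul : coeffPoly ⟨0, hn⟩ f * coeffPoly j g = 0 := by
    rw [coeffPoly_zero_mul_coeffPoly hn f g j hlow, hfg]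
    simp [coeffPoly]
  obtain ⟨c, hc, hcent⟩ : ∃ c : R, c ≠ 0 ∧
      ∀ i, (coeffPoly ⟨0, hn⟩ f).coeff i * c ∈ Set.center R := by
    by_cases hf : coeffPoly ⟨0, hn⟩ f = 0
    · exact ⟨_, hk, fun i => by simp [hf, Set.zero_mem_center]⟩
    · exact hR _ _ hf hgj hmul
  refine ⟨proj R n (C c * X ^ (n - 1)), fun h => hc ?_, fun i => ?_⟩
  · have h0 := congrArg (coeff ⟨n - 1, by omega⟩) h
    rw [coeff_proj] at h0
    simpa using h0
  · rw [mul_proj_C_mul_X_pow hn, ← coeff_coeffPoly]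
    exact proj_C_mul_X_pow_mem_center (hcent i) _

theorem isRightCentralMcCoy_of_polyModXPow (hn : 0 < n)
    (h : IsRightCentralMcCoy (PolyModXPow R n)) : IsRightCentralMcCoy R := by
  intro f g hf hg hfg
  have hinj : Function.Injective ((proj R n).comp C) := fun a b hab => by
    simpa using congrArg (coeff ⟨0, hn⟩) hab
  have hne : ∀ p : R[X], p ≠ 0 → p.map ((proj R n).comp C) ≠ 0 := fun p hp =>
    (Polynomial.map_ne_zero_iff hinj).2 hp
  obtain ⟨r, hr, hcent⟩ := h _ _ (hne f hf) (hne g hg)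
    (by rw [← Polynomial.map_mul, hfg, Polynomial.map_zero])
  obtain ⟨i, hi⟩ := exists_coeff_ne_zero hr
  refine ⟨_, hi, fun k => ?_⟩
  obtain ⟨p, rfl⟩ := proj_surjective r
  simpa [← map_mul] using coeff_mem_center (hcent k) i

end PolyModXPow

theorem isRightCentralMcCoy_iff_polyModXPow (R : Type*) [Ring R] (n : ℕ)
    (hn : 1 ≤ n) :
    IsRightCentralMcCoy R ↔ IsRightCentralMcCoy (PolyModXPow R n) :=
  ⟨PolyModXPow.isRightCentralMcCoy hn, PolyModXPow.isRightCentralMcCoy_of_polyModXPow hn⟩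
end

section
/- There exists a ring that is left Central McCoy but not right Central McCoy; namely R = K⟨a₀, b₀, a₁, b₁⟩/I where K is a field and I is the ideal generated by a₀b₀, a₀b₁ + a₁b₀, a₁b₁, and bₛbₜ for s, t ∈ {0,1}. -/
def IsLeftCentralMcCoy (R : Type*) [Ring R] : Prop :=
  ∀ f g : Polynomial R, f ≠ 0 → g ≠ 0 → f * g = 0 →
    ∃ r : R, r ≠ 0 ∧ ∀ j : ℕ, r * g.coeff j ∈ Set.center R

namespace Stmt18

variable (K : Type*) [Field K]

-- Generators: `a₀ = ι 0`, `b₀ = ι 1`, `a₁ = ι 2`, `b₁ = ι 3`.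
local notation "a₀" => FreeAlgebra.ι K (0 : Fin 4)
local notation "b₀" => FreeAlgebra.ι K (1 : Fin 4)
local notation "a₁" => FreeAlgebra.ι K (2 : Fin 4)
local notation "b₁" => FreeAlgebra.ι K (3 : Fin 4)

/-- The relations generating the ideal `I`:
`a₀b₀`, `a₀b₁ + a₁b₀`, `a₁b₁`, and `bₛbₜ` for `s, t ∈ {0, 1}`. -/
inductive Rel : FreeAlgebra K (Fin 4) → FreeAlgebra K (Fin 4) → Prop
  | r1 : Rel (a₀ * b₀) 0
  | r2 : Rel (a₀ * b₁ + a₁ * b₀) 0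
  | r3 : Rel (a₁ * b₁) 0
  | r4 : Rel (b₀ * b₀) 0
  | r5 : Rel (b₀ * b₁) 0
  | r6 : Rel (b₁ * b₀) 0
  | r7 : Rel (b₁ * b₁) 0

/-- `R = K⟨a₀, b₀, a₁, b₁⟩ / I`: a ring that is left Central McCoy but not
right Central McCoy. -/
abbrev R := RingQuot (Rel K)

/-- The free algebra on letters `e, a₀, a₁`, numbered `0, 1, 2`; it is the subalgebra of `R K`
spanned by the normal words not starting with `b₀` or `b₁`, where `e = a₀ * b₁`. -/
abbrev F := MonoidAlgebra K (FreeMonoid (Fin 3))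

variable {K}

/-- The letter `s` as an element of `F K`. -/
noncomputable def letter (s : Fin 3) : F K := MonoidAlgebra.single (FreeMonoid.of s) 1

/-- Remove the last letter `s` from every word ending in `s`, and kill the other words. -/
noncomputable def strip (s : Fin 3) : F K →ₗ[K] F K where
  toFun n := .ofCoeff (n.coeff.comapDomain (· * FreeMonoid.of s) (mul_left_injective _).injOn)
  map_add' m n := by ext; simp
  map_smul' c n := by ext; simp

lemma coeff_strip (s : Fin 3) (n : F K) (w : FreeMonoid (Fin 3)) :
    (strip s n).coeff w = n.coeff (w * FreeMonoid.of s) := by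
  simp [strip]

/-- The projection onto the constants. -/
noncomputable def const : F K →ₗ[K] F K where
  toFun n := MonoidAlgebra.single 1 (n.coeff 1)
  map_add' m n := by simp
  map_smul' c n := by simp

lemma const_apply (n : F K) : const n = MonoidAlgebra.single 1 (n.coeff 1) := rfl

lemma mul_of_inj {v w : FreeMonoid (Fin 3)} {s t : Fin 3} :
    v * FreeMonoid.of s = w * FreeMonoid.of t ↔ v = w ∧ s = t :=
  List.append_singleton_inj

lemma mul_of_ne_one (v : FreeMonoid (Fin 3)) (s : Fin 3) : v * FreeMonoid.of s ≠ 1 :=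
  List.append_ne_nil_of_right_ne_nil _ (List.cons_ne_nil _ _)

@[simp] lemma strip_mul_letter (s : Fin 3) (n : F K) : strip s (n * letter s) = n := by
  ext w
  rw [coeff_strip, letter, MonoidAlgebra.coeff_mul_single_eq_coeff_mul w (by simp), mul_one]

lemma strip_mul_letter_of_ne {s t : Fin 3} (h : s ≠ t) (n : F K) :
    strip s (n * letter t) = 0 := by
  ext w
  rw [coeff_strip, letter, MonoidAlgebra.coeff_mul_single_of_forall_mul_ne]
  · simp
  · exact fun d hd ↦ h (mul_of_inj.1 hd).2.symm

@[simp] lemma const_mul_letter (s : Fin 3) (n : F K) : const (n * letter s) = 0 := by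
  rw [const_apply, letter, MonoidAlgebra.coeff_mul_single_of_forall_mul_ne _ _
    (fun d ↦ mul_of_ne_one d s), MonoidAlgebra.single_zero]

@[simp] lemma strip_single_one (s : Fin 3) (c : K) :
    strip s (MonoidAlgebra.single 1 c : F K) = 0 := by
  ext w
  simp [coeff_strip]

@[simp] lemma strip_const (s : Fin 3) (n : F K) : strip s (const n) = 0 :=
  strip_single_one _ _

@[simp] lemma strip_one (s : Fin 3) : strip s (1 : F K) = 0 :=
  strip_single_one _ _

@[simp] lemma const_one : const (1 : F K) = 1 := by
  simp [const_apply, MonoidAlgebra.one_def]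

variable (K) in
/-- Underlying space of the right regular representation of `R K`: `(n, u, v)` stands for
`n + b₀ * u + b₁ * v`. -/
abbrev V := F K × F K × F K

/-- Right multiplication by a letter. -/
noncomputable def actA (s : Fin 3) : Module.End K (V K) :=
  (LinearMap.mulRight K (letter s)).prodMap
    ((LinearMap.mulRight K (letter s)).prodMap (LinearMap.mulRight K (letter s)))

/-- Right multiplication by `b₀`. -/
noncomputable def actB0 : Module.End K (V K) where
  toFun x := (-(strip 2 x.1 * letter 0), -(strip 2 x.2.1 * letter 0) + const x.1,
    -(strip 2 x.2.2 * letter 0))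
  map_add' x y := by simp [add_mul]; abel_nf; trivial
  map_smul' c x := by simp

/-- Right multiplication by `b₁`. -/
noncomputable def actB1 : Module.End K (V K) where
  toFun x := (strip 1 x.1 * letter 0, strip 1 x.2.1 * letter 0,
    strip 1 x.2.2 * letter 0 + const x.1)
  map_add' x y := by simp [add_mul]; abel_nf
  map_smul' c x := by simp

lemma actA_apply (s : Fin 3) (x : V K) :
    actA s x = (x.1 * letter s, x.2.1 * letter s, x.2.2 * letter s) := rfl

lemma actB0_apply (x : V K) :
    actB0 x = (-(strip 2 x.1 * letter 0), -(strip 2 x.2.1 * letter 0) + const x.1,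
      -(strip 2 x.2.2 * letter 0)) := rfl

lemma actB1_apply (x : V K) :
    actB1 x = (strip 1 x.1 * letter 0, strip 1 x.2.1 * letter 0,
      strip 1 x.2.2 * letter 0 + const x.1) := rfl

/-- The right multiplications by the generators of `R K`. -/
noncomputable def actGen : Fin 4 → (Module.End K (V K))ᵐᵒᵖ :=
  ![.op (actA 1), .op actB0, .op (actA 2), .op actB1]

variable (K) in
/-- The right regular representation of `R K`. -/
noncomputable def rep : R K →ₐ[K] (Module.End K (V K))ᵐᵒᵖ :=
  RingQuot.liftAlgHom K ⟨FreeAlgebra.lift K actGen, by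
    have h12 := strip_mul_letter_of_ne (K := K) (show (1 : Fin 3) ≠ 2 by decide)
    have h21 := strip_mul_letter_of_ne (K := K) (show (2 : Fin 3) ≠ 1 by decide)
    have h10 := strip_mul_letter_of_ne (K := K) (show (1 : Fin 3) ≠ 0 by decide)
    have h20 := strip_mul_letter_of_ne (K := K) (show (2 : Fin 3) ≠ 0 by decide)
    intro x y h
    apply MulOpposite.unop_injective
    refine LinearMap.ext fun v ↦ ?_
    cases h <;>
      simp [actGen, actA_apply, actB0_apply, actB1_apply, h12, h21, h10, h20]⟩

variable (K) in
/-- The generators of `R K`. -/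
noncomputable def gen (i : Fin 4) : R K := RingQuot.mkAlgHom K (Rel K) (FreeAlgebra.ι K i)

/-- The right action of `R K` on `V K`. -/
noncomputable def act (x : V K) (r : R K) : V K := (rep K r).unop x

lemma act_add (x : V K) (r s : R K) : act x (r + s) = act x r + act x s := by simp [act]

lemma act_smul (x : V K) (c : K) (r : R K) : act x (c • r) = c • act x r := by simp [act]

lemma act_mul (x : V K) (r s : R K) : act x (r * s) = act (act x r) s := by simp [act]

lemma act_one (x : V K) : act x 1 = x := by simp [act]

lemma act_zero (x : V K) : act x 0 = 0 := by simp [act]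

lemma rep_gen (i : Fin 4) : rep K (gen K i) = actGen i := by
  simp [rep, gen, RingQuot.liftAlgHom_mkAlgHom_apply]

lemma act_gen_zero (x : V K) : act x (gen K 0) = actA 1 x := by simp [act, rep_gen, actGen]
lemma act_gen_one (x : V K) : act x (gen K 1) = actB0 x := by simp [act, rep_gen, actGen]
lemma act_gen_two (x : V K) : act x (gen K 2) = actA 2 x := by simp [act, rep_gen, actGen]
lemma act_gen_three (x : V K) : act x (gen K 3) = actB1 x := by simp [act, rep_gen, actGen]

@[elab_as_elim]
lemma R_induction {motive : R K → Prop} (algebraMap : ∀ c, motive (algebraMap K (R K) c))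
    (gen : ∀ i, motive (gen K i)) (mul : ∀ r s, motive r → motive s → motive (r * s))
    (add : ∀ r s, motive r → motive s → motive (r + s)) (r : R K) : motive r := by
  obtain ⟨x, rfl⟩ := RingQuot.mkAlgHom_surjective K (Rel K) r
  induction x using FreeAlgebra.induction with
  | grade0 c => rw [AlgHom.commutes]; exact algebraMap c
  | grade1 i => exact gen i
  | mul a b ha hb => rw [map_mul]; exact mul _ _ ha hb
  | add a b ha hb => rw [map_add]; exact add _ _ ha hb

lemma gen_zero_mul_gen_one : gen K 0 * gen K 1 = 0 := by
  simpa using! RingQuot.mkAlgHom_rel K (Rel.r1 (K := K))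

lemma gen_two_mul_gen_three : gen K 2 * gen K 3 = 0 := by
  simpa using! RingQuot.mkAlgHom_rel K (Rel.r3 (K := K))

lemma gen_two_mul_gen_one : gen K 2 * gen K 1 = -(gen K 0 * gen K 3) := by
  rw [eq_neg_iff_add_eq_zero, add_comm]
  simpa using! RingQuot.mkAlgHom_rel K (Rel.r2 (K := K))

lemma gen_one_mul_gen_one : gen K 1 * gen K 1 = 0 := by
  simpa using! RingQuot.mkAlgHom_rel K (Rel.r4 (K := K))

lemma gen_one_mul_gen_three : gen K 1 * gen K 3 = 0 := by
  simpa using! RingQuot.mkAlgHom_rel K (Rel.r5 (K := K))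

lemma gen_three_mul_gen_one : gen K 3 * gen K 1 = 0 := by
  simpa using! RingQuot.mkAlgHom_rel K (Rel.r6 (K := K))

lemma gen_three_mul_gen_three : gen K 3 * gen K 3 = 0 := by
  simpa using! RingQuot.mkAlgHom_rel K (Rel.r7 (K := K))

variable (K) in
/-- The embedding of the free algebra `F K` into `R K`. -/
noncomputable def incl : F K →ₐ[K] R K :=
  MonoidAlgebra.lift K (R K) (FreeMonoid (Fin 3))
    (FreeMonoid.lift ![gen K 0 * gen K 3, gen K 0, gen K 2])

lemma incl_letter_zero : incl K (letter 0) = gen K 0 * gen K 3 := by simp [incl, letter]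
lemma incl_letter_one : incl K (letter 1) = gen K 0 := by simp [incl, letter]
lemma incl_letter_two : incl K (letter 2) = gen K 2 := by simp [incl, letter]

@[elab_as_elim]
lemma F_induction {motive : F K → Prop} (one : motive 1)
    (mul_letter : ∀ n s, motive n → motive (n * letter s))
    (add : ∀ m n, motive m → motive n → motive (m + n))
    (smul : ∀ (c : K) n, motive n → motive (c • n)) (n : F K) : motive n := by
  induction n using MonoidAlgebra.induction_on with
  | of w =>
    induction w using List.reverseRecOn with
    | nil => exact one
    | append_singleton w s ih =>
      have h : MonoidAlgebra.of K (FreeMonoid (Fin 3)) (w ++ [s]) =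
          MonoidAlgebra.of K (FreeMonoid (Fin 3)) w * letter s := by
        exact (MonoidAlgebra.of K (FreeMonoid (Fin 3))).map_mul w (FreeMonoid.of s)
      exact h ▸ mul_letter _ s ih
  | add x y hx hy => exact add x y hx hy
  | smul c x hx => exact smul c x hx

lemma act_incl (x : V K) (m : F K) : act x (incl K m) = (x.1 * m, x.2.1 * m, x.2.2 * m) := by
  induction m using F_induction with
  | one => simp [act_one]
  | mul_letter n s ih =>
    rw [map_mul, act_mul, ih]
    fin_cases s
    · simp [incl_letter_zero, act_mul, act_gen_zero, act_gen_three, actA_apply, actB1_apply,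
        mul_assoc]
      simp [← mul_assoc]
    · simp [incl_letter_one, act_gen_zero, actA_apply, mul_assoc]
    · simp [incl_letter_two, act_gen_two, actA_apply, mul_assoc]
  | add m n hm hn => simp [act_add, hm, hn, mul_add]
  | smul c n hn => simp [act_smul, hn]

/-- The element `n + b₀ * u + b₁ * v` of `R K`. -/
noncomputable def toR (x : V K) : R K :=
  incl K x.1 + gen K 1 * incl K x.2.1 + gen K 3 * incl K x.2.2

lemma act_toR (x y : V K) : act x (toR y) =
    (x.1 * y.1 - strip 2 x.1 * letter 0 * y.2.1 + strip 1 x.1 * letter 0 * y.2.2,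
     x.2.1 * y.1 + (-(strip 2 x.2.1 * letter 0) + const x.1) * y.2.1
      + strip 1 x.2.1 * letter 0 * y.2.2,
     x.2.2 * y.1 - strip 2 x.2.2 * letter 0 * y.2.1
      + (strip 1 x.2.2 * letter 0 + const x.1) * y.2.2) := by
  simp [toR, act_add, act_mul, act_incl, act_gen_one, act_gen_three, actB0_apply, actB1_apply,
    sub_eq_add_neg]

lemma incl_mul_gen_one (n : F K) : incl K n * gen K 1 =
    incl K (-(strip 2 n * letter 0)) + gen K 1 * incl K (const n) := by
  have h21 := strip_mul_letter_of_ne (K := K) (show (2 : Fin 3) ≠ 1 by decide)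
  have h20 := strip_mul_letter_of_ne (K := K) (show (2 : Fin 3) ≠ 0 by decide)
  induction n using F_induction with
  | one => simp
  | mul_letter n s ih =>
    clear ih
    fin_cases s
    · simp [h20, incl_letter_zero, mul_assoc, gen_three_mul_gen_one]
    · simp [h21, incl_letter_one, mul_assoc, gen_zero_mul_gen_one]
    · simp [incl_letter_two, incl_letter_zero, mul_assoc, gen_two_mul_gen_one]
      exact mul_neg (incl K n) (gen K 0 * gen K 3)
  | add m n hm hn => simp only [map_add, add_mul, mul_add, hm, hn, neg_add]; abel
  | smul c n hn => simp [hn]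

lemma incl_mul_gen_three (n : F K) : incl K n * gen K 3 =
    incl K (strip 1 n * letter 0) + gen K 3 * incl K (const n) := by
  have h12 := strip_mul_letter_of_ne (K := K) (show (1 : Fin 3) ≠ 2 by decide)
  have h10 := strip_mul_letter_of_ne (K := K) (show (1 : Fin 3) ≠ 0 by decide)
  induction n using F_induction with
  | one => simp
  | mul_letter n s ih =>
    clear ih
    fin_cases s
    · simp [h10, incl_letter_zero, mul_assoc, gen_three_mul_gen_three]
    · simp [incl_letter_one, incl_letter_zero, mul_assoc]
    · simp [h12, incl_letter_two, mul_assoc, gen_two_mul_gen_three]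
  | add m n hm hn => simp only [map_add, add_mul, mul_add, hm, hn]; abel
  | smul c n hn => simp [hn]

lemma toR_act (x : V K) (r : R K) : toR (act x r) = toR x * r := by
  induction r using R_induction generalizing x with
  | algebraMap c =>
    rw [Algebra.algebraMap_eq_smul_one, act_smul, act_one]
    simp [toR]
  | gen i =>
    fin_cases i
    · simp [act_gen_zero, actA_apply, toR, incl_letter_one, add_mul, mul_assoc]
    · have h : gen K 1 * (gen K 1 * incl K (const x.2.1)) = 0 := by
        rw [← mul_assoc, gen_one_mul_gen_one, zero_mul]
      have h' : gen K 3 * (gen K 1 * incl K (const x.2.2)) = 0 := by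
        rw [← mul_assoc, gen_three_mul_gen_one, zero_mul]
      simp only [Fin.mk_one, act_gen_one, actB0_apply, toR, add_mul, mul_assoc, incl_mul_gen_one,
        mul_add, h, h', map_add]
      abel
    · simp [act_gen_two, actA_apply, toR, incl_letter_two, add_mul, mul_assoc]
    · have h : gen K 1 * (gen K 3 * incl K (const x.2.1)) = 0 := by
        rw [← mul_assoc, gen_one_mul_gen_three, zero_mul]
      have h' : gen K 3 * (gen K 3 * incl K (const x.2.2)) = 0 := by
        rw [← mul_assoc, gen_three_mul_gen_three, zero_mul]
      simp only [Fin.reduceFinMk, act_gen_three, actB1_apply, toR, add_mul, mul_assoc,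
        incl_mul_gen_three, mul_add, h, h', map_add]
      abel
  | mul r s hr hs => rw [act_mul, hs, hr, mul_assoc]
  | add r s hr hs =>
    rw [act_add, mul_add, ← hr, ← hs]
    simp only [toR, Prod.fst_add, Prod.snd_add, map_add, mul_add]
    abel

/-- The normal form of an element of `R K`. -/
noncomputable def normal (r : R K) : V K := act (1, 0, 0) r

@[simp] lemma toR_normal (r : R K) : toR (normal r) = r := by
  rw [normal, toR_act]
  simp [toR]

@[simp] lemma normal_toR (x : V K) : normal (toR x) = x := by
  simp [normal, act_toR]

lemma toR_injective : Function.Injective (toR (K := K)) :=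
  Function.LeftInverse.injective normal_toR

lemma exists_sum_antidiagonal_ne_zero {c d : ℕ → K} (hc : c ≠ 0) (hd : d ≠ 0) :
    ∃ n, ∑ ij ∈ Finset.HasAntidiagonal.antidiagonal n, c ij.1 * d ij.2 ≠ 0 := by
  have h : PowerSeries.mk c * PowerSeries.mk d ≠ 0 := by
    refine mul_ne_zero (fun h ↦ hc ?_) (fun h ↦ hd ?_)
    all_goals
      ext n
      simpa using congrArg (PowerSeries.coeff n) h
  by_contra! H
  refine h (PowerSeries.ext fun n ↦ ?_)
  simpa [PowerSeries.coeff_mul] using H n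

lemma exists_max_word {N : ℕ → F K} (hN : N ≠ 0) (hfin : N.support.Finite)
    (φ : FreeMonoid (Fin 3) → List (Fin 3)) :
    ∃ y j, (N j).coeff y ≠ 0 ∧ ∀ z k, (N k).coeff z ≠ 0 → φ z ≤ φ y := by
  classical
  let S := hfin.toFinset.biUnion fun j ↦ (N j).coeff.support
  have mem_S {z k} (h : (N k).coeff z ≠ 0) : z ∈ S := by
    refine Finset.mem_biUnion.2 ⟨k, ?_, Finsupp.mem_support_iff.2 h⟩
    simp only [Set.Finite.mem_toFinset, Function.mem_support]
    rintro h0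
    simp [h0] at h
  have hS : S.Nonempty := by
    obtain ⟨j, hj⟩ := Function.ne_iff.1 hN
    obtain ⟨z, hz⟩ := Finsupp.ne_iff.1 (mt MonoidAlgebra.coeff_eq_zero.1 hj)
    exact ⟨z, mem_S hz⟩
  obtain ⟨y, hy, hmax⟩ := S.exists_max_image φ hS
  obtain ⟨j, -, hj⟩ := Finset.mem_biUnion.1 hy
  exact ⟨y, j, Finsupp.mem_support_iff.1 hj, fun z k h ↦ hmax z (mem_S h)⟩

/-- Moving a letter `s ≠ e` at the end of a word of `n` to `e` gives lexicographically smaller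
words, whatever is appended. -/
lemma coeff_strip_mul_letter_zero_mul {s : Fin 3} (hs : 0 < s) (n U : F K)
    {w y : FreeMonoid (Fin 3)}
    (h : ∀ z, n.coeff z ≠ 0 → (z * y).toList ≤ (w * y).toList) :
    (strip s n * letter 0 * U).coeff (w * y) = 0 := by
  classical
  by_contra hne
  have hmem := MonoidAlgebra.support_coeff_mul_subset _ _ (Finsupp.mem_support_iff.2 hne)
  obtain ⟨p, hp, z, -, hpz⟩ := Finset.mem_mul.1 hmem
  obtain ⟨v, hv, rfl⟩ := Finset.mem_image.1
    (MonoidAlgebra.support_coeff_mul_single_subset _ _ _ hp)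
  rw [Finsupp.mem_support_iff, coeff_strip] at hv
  refine (h _ hv).not_gt ?_
  rw [← hpz]
  simp only [FreeMonoid.toList_mul, FreeMonoid.toList_of, List.append_assoc]
  exact List.append_left_lt (List.Lex.rel hs)

lemma coeff_mul_of_max {n N : F K} {w y : FreeMonoid (Fin 3)}
    (hw : ∀ z, n.coeff z ≠ 0 → (z * y).toList ≤ (w * y).toList)
    (hy : ∀ z, N.coeff z ≠ 0 → z.toList ≤ y.toList) :
    (n * N).coeff (w * y) = n.coeff w * N.coeff y := by
  refine MonoidAlgebra.coeff_mul_mul_of_uniqueMul fun a b ha hb hab ↦ ?_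
  have hby : b = y := by
    refine FreeMonoid.toList.injective ((hy b (Finsupp.mem_support_iff.1 hb)).eq_of_not_lt ?_)
    intro hlt
    refine (hw a (Finsupp.mem_support_iff.1 ha)).not_gt ?_
    rw [← hab, FreeMonoid.toList_mul, FreeMonoid.toList_mul]
    exact List.append_left_lt hlt
  subst hby
  exact ⟨mul_right_cancel hab, rfl⟩

lemma eq_zero_of_sum_antidiagonal_eq_zero {p N U W : ℕ → F K} (hp : p ≠ 0)
    (hpfin : p.support.Finite) (hNfin : N.support.Finite)
    (h : ∀ n, ∑ ij ∈ Finset.HasAntidiagonal.antidiagonal n, (p ij.1 * N ij.2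
      - strip 2 (p ij.1) * letter 0 * U ij.2 + strip 1 (p ij.1) * letter 0 * W ij.2) = 0) :
    N = 0 := by
  by_contra hN
  obtain ⟨y, j, hj, hy⟩ := exists_max_word hN hNfin FreeMonoid.toList
  obtain ⟨w, i, hi, hw⟩ := exists_max_word hp hpfin fun w ↦ (w * y).toList
  obtain ⟨n, hn⟩ := exists_sum_antidiagonal_ne_zero
    (c := fun i ↦ (p i).coeff w) (d := fun j ↦ (N j).coeff y)
    (Function.ne_iff.2 ⟨i, hi⟩) (Function.ne_iff.2 ⟨j, hj⟩)
  refine hn ?_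
  have hcoeff := congrArg (fun m : F K ↦ m.coeff (w * y)) (h n)
  simp only [MonoidAlgebra.coeff_sum, Finsupp.finsetSum_apply, MonoidAlgebra.coeff_zero,
    Finsupp.coe_zero, Pi.zero_apply] at hcoeff
  rw [← hcoeff]
  refine Finset.sum_congr rfl fun ij _ ↦ ?_
  have hw' := fun z ↦ hw z ij.1
  simp [coeff_mul_of_max hw' fun z ↦ hy z ij.2, coeff_strip_mul_letter_zero_mul _ _ _ hw']

lemma act_sum {ι : Type*} (x : V K) (s : Finset ι) (r : ι → R K) :
    act x (∑ i ∈ s, r i) = ∑ i ∈ s, act x (r i) := by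
  simp [act]

lemma normal_zero : normal (0 : R K) = 0 := act_zero _

lemma normal_mul (r s : R K) : normal (r * s) = act (normal r) (toR (normal s)) := by
  rw [toR_normal, normal, act_mul, normal]

lemma sum_antidiagonal_act_eq_zero {f g : Polynomial (R K)} (h : f * g = 0) (n : ℕ) :
    ∑ ij ∈ Finset.HasAntidiagonal.antidiagonal n,
      act (normal (f.coeff ij.1)) (toR (normal (g.coeff ij.2))) = 0 := by
  simp_rw [← normal_mul]
  rw [← normal_zero, ← Polynomial.coeff_zero n, ← h, Polynomial.coeff_mul]
  exact (act_sum _ _ _).symm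

lemma finite_support_normal (f : Polynomial (R K)) {φ : V K → F K} (hφ : φ 0 = 0) :
    (fun i ↦ φ (normal (f.coeff i))).support.Finite := by
  refine f.support.finite_toSet.subset fun i hi ↦ ?_
  simp only [Finset.mem_coe, Polynomial.mem_support_iff]
  rintro h0
  exact hi (by simp [h0, normal_zero, hφ])

lemma normal_coeff_fst_eq_zero {f g : Polynomial (R K)} (hf : f ≠ 0) (h : f * g = 0) (j : ℕ) :
    (normal (g.coeff j)).1 = 0 := by
  have hsum := sum_antidiagonal_act_eq_zero h
  have hg := finite_support_normal g (φ := fun x ↦ x.1) rfl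
  simp_rw [act_toR] at hsum
  suffices H : (fun j ↦ (normal (g.coeff j)).1) = 0 from congrFun H j
  by_cases h1 : (fun i ↦ (normal (f.coeff i)).1) = 0
  · have h1' i : (normal (f.coeff i)).1 = 0 := congrFun h1 i
    simp only [h1', map_zero, add_zero] at hsum
    by_cases h2 : (fun i ↦ (normal (f.coeff i)).2.1) = 0
    · have h2' i : (normal (f.coeff i)).2.1 = 0 := congrFun h2 i
      refine eq_zero_of_sum_antidiagonal_eq_zero (p := fun i ↦ (normal (f.coeff i)).2.2)
        (U := fun j ↦ (normal (g.coeff j)).2.1) (W := fun j ↦ (normal (g.coeff j)).2.2)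
        (fun h3 ↦ hf ?_) (finite_support_normal f (φ := fun x ↦ x.2.2) rfl) hg fun n ↦ ?_
      · ext i
        rw [← toR_normal (f.coeff i)]
        simp [toR, h1' i, h2' i, congrFun h3 i]
      · simpa [Prod.snd_sum] using congrArg (fun x : V K ↦ x.2.2) (hsum n)
    · refine eq_zero_of_sum_antidiagonal_eq_zero (U := fun j ↦ (normal (g.coeff j)).2.1)
        (W := fun j ↦ (normal (g.coeff j)).2.2) h2
        (finite_support_normal f (φ := fun x ↦ x.2.1) rfl) hg fun n ↦ ?_
      simpa [Prod.snd_sum, Prod.fst_sum, sub_eq_add_neg] using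
        congrArg (fun x : V K ↦ x.2.1) (hsum n)
  · refine eq_zero_of_sum_antidiagonal_eq_zero (U := fun j ↦ (normal (g.coeff j)).2.1)
      (W := fun j ↦ (normal (g.coeff j)).2.2) h1
      (finite_support_normal f (φ := fun x ↦ x.1) rfl) hg fun n ↦ ?_
    simpa [Prod.fst_sum] using congrArg (fun x : V K ↦ x.1) (hsum n)

lemma gen_ne_zero (i : Fin 4) : gen K i ≠ 0 := by
  intro h
  have hact : act (1, 0, 0) (gen K i) = 0 := h ▸ act_zero _
  fin_cases i <;>
    simp [act_gen_zero, act_gen_one, act_gen_two, act_gen_three, actA_apply, actB0_apply,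
      actB1_apply, letter] at hact

variable (K) in
lemma isLeftCentralMcCoy : IsLeftCentralMcCoy (R K) := by
  intro f g hf _ hfg
  refine ⟨gen K 1, gen_ne_zero 1, fun j ↦ ?_⟩
  have h : gen K 1 * g.coeff j = 0 := by
    rw [← toR_normal (g.coeff j), toR, normal_coeff_fst_eq_zero hf hfg j, map_zero, zero_add,
      mul_add, ← mul_assoc, ← mul_assoc, gen_one_mul_gen_one, gen_one_mul_gen_three,
      zero_mul, zero_mul, add_zero]
  rw [h]
  exact Set.zero_mem_center

/-- Central elements of the subalgebra `F K` vanish if they have no constant term. -/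
lemma eq_zero_of_incl_mem_center {m : F K} (hm : const m = 0)
    (h : incl K m ∈ Set.center (R K)) : m = 0 := by
  have hcomm : incl K m * gen K 1 = gen K 1 * incl K m := (h.comm (gen K 1)).eq
  have h1 : gen K 1 * incl K m = toR (0, m, 0) := by simp [toR]
  have h2 : incl K m * gen K 1 = toR (-(strip 2 m * letter 0), 0, 0) := by
    rw [incl_mul_gen_one, hm]
    simp [toR]
  rw [h1, h2] at hcomm
  exact (congrArg (fun x : V K ↦ x.2.1) (toR_injective hcomm)).symm

lemma const_letter_mul (s : Fin 3) (n : F K) : const (letter s * n) = 0 := by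
  rw [const_apply, letter, MonoidAlgebra.coeff_single_mul_of_forall_mul_ne _ _
    (fun d : FreeMonoid (Fin 3) ↦ List.cons_ne_nil s d.toList), MonoidAlgebra.single_zero]

lemma letter_mul_add_eq_zero {s : Fin 3} (hs : s ≠ 0) {m n : F K}
    (h : letter s * m + letter 0 * n = 0) : m = 0 ∧ n = 0 := by
  have hcoeff (t : Fin 3) (x : F K) (w : FreeMonoid (Fin 3)) :
      (letter t * x).coeff (FreeMonoid.of t * w) = x.coeff w := by
    rw [letter, MonoidAlgebra.coeff_single_mul_eq_mul_coeff w (by simp), one_mul]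
  have hne {t t' : Fin 3} (htt : t ≠ t') (x : F K) (w : FreeMonoid (Fin 3)) :
      (letter t * x).coeff (FreeMonoid.of t' * w) = 0 :=
    MonoidAlgebra.coeff_single_mul_of_forall_mul_ne _ _
      fun d hd ↦ htt (List.cons_eq_cons.1 hd).1
  constructor <;> ext w
  · have := congrArg (fun x : F K ↦ x.coeff (FreeMonoid.of s * w)) h
    rwa [MonoidAlgebra.coeff_add, Finsupp.add_apply, hcoeff, hne hs.symm, add_zero] at this
  · have := congrArg (fun x : F K ↦ x.coeff (FreeMonoid.of 0 * w)) h
    rwa [MonoidAlgebra.coeff_add, Finsupp.add_apply, hcoeff, hne hs, zero_add] at this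

variable (K) in
lemma not_isRightCentralMcCoy : ¬ IsRightCentralMcCoy (R K) := by
  intro H
  let f : Polynomial (R K) := .C (gen K 0) + .C (gen K 2) * .X
  let g : Polynomial (R K) := .C (gen K 1) + .C (gen K 3) * .X
  have hf0 : f.coeff 0 = gen K 0 := by simp [f]
  have hf1 : f.coeff 1 = gen K 2 := by simp [f, Polynomial.coeff_C]
  have hg0 : g.coeff 0 = gen K 1 := by simp [g]
  have hfg : f * g = 0 := by
    have : f * g = .C (gen K 0 * gen K 1) + .C (gen K 0 * gen K 3 + gen K 2 * gen K 1) * .X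
        + .C (gen K 2 * gen K 3) * .X ^ 2 := by
      simp only [f, g, map_mul, map_add, mul_add, add_mul, mul_assoc, pow_two,
        Polynomial.X_mul]
      abel
    rw [this, gen_zero_mul_gen_one, gen_two_mul_gen_three, gen_two_mul_gen_one]
    simp
  obtain ⟨r, hr, hcent⟩ := H f g
    (fun h ↦ gen_ne_zero 0 (by rw [← hf0, h, Polynomial.coeff_zero]))
    (fun h ↦ gen_ne_zero 1 (by rw [← hg0, h, Polynomial.coeff_zero])) hfg
  refine hr ?_
  obtain ⟨⟨n, u, v⟩, rfl⟩ : ∃ x, toR x = r := ⟨_, toR_normal r⟩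
  have h0 : gen K 0 * toR (n, u, v) = incl K (letter 1 * n + letter 0 * v) := by
    simp [toR, mul_add, ← mul_assoc, gen_zero_mul_gen_one, incl_letter_one, incl_letter_zero]
  have h1 : gen K 2 * toR (n, u, v) = incl K (letter 2 * n + letter 0 * (-u)) := by
    rw [toR, mul_add, mul_add, ← mul_assoc, ← mul_assoc, gen_two_mul_gen_one,
      gen_two_mul_gen_three, map_add, map_mul, map_mul, incl_letter_zero, incl_letter_two,
      map_neg, zero_mul, add_zero]
    congr 1
    exact (neg_mul (gen K 0 * gen K 3) (incl K u)).trans (mul_neg _ (incl K u)).symm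
  have hc0 := hcent 0
  have hc1 := hcent 1
  rw [hf0, h0] at hc0
  rw [hf1, h1] at hc1
  obtain ⟨rfl, rfl⟩ := letter_mul_add_eq_zero (by decide)
    (eq_zero_of_incl_mem_center (by simp [const_letter_mul]) hc0)
  obtain ⟨-, hu⟩ := letter_mul_add_eq_zero (by decide)
    (eq_zero_of_incl_mem_center (by rw [map_add, const_letter_mul, const_letter_mul, add_zero]) hc1)
  rw [neg_eq_zero.1 hu]
  simp [toR]

theorem main : IsLeftCentralMcCoy (R K) ∧ ¬ IsRightCentralMcCoy (R K) :=
  ⟨isLeftCentralMcCoy K, not_isRightCentralMcCoy K⟩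

end Stmt18
end
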